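/- Let 𝔤 be a finite-dimensional complex semisimple Lie algebra, σ an involution of 𝔤 with 𝔥 := ker(σ − id) and 𝔮 := ker(σ + id), 𝔞 a Cartan subspace of 𝔮, and for a linear functional α on 𝔞 set 𝔮_α := {X ∈ 𝔮 : (ad a)²(X) = α(a)²·X for all a ∈ 𝔞}, with Δ := {α ≠ 0 : 𝔮_α ≠ 0}. Then for every w ∈ 𝔞, the image of 𝔥 under ad(w) equals the sum of those restricted root spaces 𝔮_α with α(w) ≠ 0: {[Z, w] : Z ∈ 𝔥} = Σ_{α ∈ Δ, α(w) ≠ 0} 𝔮_α. (This is the tangent space computation T_w(Ad(H^c)·w) = Σ_{α(w)≠0} 𝔮^c_α underlying Proposition 3.2(i), which identifies the tangent and normal spaces of an orbit of the isotropy action.) -/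

import Mathlib

section

variable {𝔤 : Type*} [LieRing 𝔤] [LieAlgebra ℂ 𝔤]

/-- The `+1`-eigenspace `ker (σ - id)` of a linear involution. -/
def fixedSpace (σ : 𝔤 →ₗ⁅ℂ⁆ 𝔤) : Submodule ℂ 𝔤 :=
  LinearMap.ker (σ.toLinearMap - (LinearMap.id : 𝔤 →ₗ[ℂ] 𝔤))

/-- The `-1`-eigenspace `ker (σ + id)` of a linear involution. -/
def antifixedSpace (σ : 𝔤 →ₗ⁅ℂ⁆ 𝔤) : Submodule ℂ 𝔤 :=
  LinearMap.ker (σ.toLinearMap + (LinearMap.id : 𝔤 →ₗ[ℂ] 𝔤))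

/-- The restricted root space `{X ∈ V : (ad a)² X = α(a)² • X for all a ∈ 𝔞}`. -/
def restrictedRootSpace (V 𝔞 : Submodule ℂ 𝔤) (α : Module.Dual ℂ 𝔞) : Submodule ℂ 𝔤 :=
  V ⊓ ⨅ a : 𝔞, LinearMap.ker
    (((LieAlgebra.ad ℂ 𝔤 (a : 𝔤)) ^ 2 - α a ^ 2 • (1 : Module.End ℂ 𝔤) : Module.End ℂ 𝔤) :
      𝔤 →ₗ[ℂ] 𝔤)

end

/-- A diagonalizable endomorphism has no proper generalised eigenvectors. -/
lemma maxGenEigenspace_eq_eigenspace_of_iSup_eigenspace_eq_top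
    {K V : Type*} [Field K] [AddCommGroup V] [Module K V] {f : Module.End K V}
    (hf : ⨆ μ, f.eigenspace μ = ⊤) (μ : K) :
    f.maxGenEigenspace μ = f.eigenspace μ := by
  have hle (ν : K) : f.eigenspace ν ≤ f.maxGenEigenspace ν :=
    (f.genEigenspace ν).monotone le_top
  refine le_antisymm ?_ (hle μ)
  have hsplit : f.eigenspace μ ⊔ ⨆ ν ≠ μ, f.maxGenEigenspace ν = ⊤ := by
    rw [eq_top_iff, ← hf]
    refine iSup_le fun ν ↦ ?_
    by_cases h : ν = μ
    · exact h ▸ le_sup_left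
    · exact ((hle ν).trans (le_iSup₂_of_le ν h le_rfl)).trans le_sup_right
  have hdisj := (f.independent_genEigenspace ⊤ μ).eq_bot
  calc f.maxGenEigenspace μ
      = (f.eigenspace μ ⊔ ⨆ ν ≠ μ, f.maxGenEigenspace ν) ⊓ f.maxGenEigenspace μ := by
        rw [hsplit, top_inf_eq]
    _ = f.eigenspace μ ⊔ (⨆ ν ≠ μ, f.maxGenEigenspace ν) ⊓ f.maxGenEigenspace μ :=
        sup_inf_assoc_of_le _ (hle μ)
    _ ≤ f.eigenspace μ := by
        rw [inf_comm]
        exact ((congrArg _ hdisj).trans (sup_bot_eq _)).le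

/-- A commuting family of diagonalizable endomorphisms is simultaneously diagonalizable. -/
lemma iSup_iInf_eigenspace_eq_top_of_commute
    {ι K V : Type*} [Field K] [AddCommGroup V] [Module K V] [FiniteDimensional K V]
    (f : ι → Module.End K V) (hcomm : ∀ i j, Commute (f i) (f j))
    (hf : ∀ i, ⨆ μ, (f i).eigenspace μ = ⊤) :
    ⨆ χ : ι → K, ⨅ i, (f i).eigenspace (χ i) = ⊤ := by
  have h (i : ι) (μ : K) := maxGenEigenspace_eq_eigenspace_of_iSup_eigenspace_eq_top (hf i) μ
  simpa only [h] using
    Module.End.iSup_iInf_maxGenEigenspace_eq_top_of_iSup_maxGenEigenspace_eq_top_of_commute f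
      (fun i j _ ↦ hcomm i j) (fun i ↦ by simpa only [h] using hf i)

section

variable {𝔤 : Type*} [LieRing 𝔤] [LieAlgebra ℂ 𝔤]

lemma mem_fixedSpace {σ : 𝔤 →ₗ⁅ℂ⁆ 𝔤} {X : 𝔤} : X ∈ fixedSpace σ ↔ σ X = X := by
  simp [fixedSpace, sub_eq_zero]

lemma mem_antifixedSpace {σ : 𝔤 →ₗ⁅ℂ⁆ 𝔤} {X : 𝔤} : X ∈ antifixedSpace σ ↔ σ X = -X := by
  simp [antifixedSpace, add_eq_zero_iff_eq_neg]

lemma mem_restrictedRootSpace {V 𝔞 : Submodule ℂ 𝔤} {α : Module.Dual ℂ 𝔞} {X : 𝔤} :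
    X ∈ restrictedRootSpace V 𝔞 α ↔ X ∈ V ∧ ∀ a : 𝔞, ⁅(a : 𝔤), ⁅(a : 𝔤), X⁆⁆ = α a ^ 2 • X := by
  simp [restrictedRootSpace, pow_two, sub_eq_zero]

/-- The simultaneous eigenvalues of a nonzero vector under `ad 𝔞` form a linear functional. -/
lemma exists_dual_of_forall_lie_eq_smul {𝔞 : Submodule ℂ 𝔤} {χ : 𝔞 → ℂ} {X : 𝔤} (hX : X ≠ 0)
    (h : ∀ a : 𝔞, ⁅(a : 𝔤), X⁆ = χ a • X) : ∃ α : Module.Dual ℂ 𝔞, ∀ a, α a = χ a := by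
  refine ⟨⟨⟨χ, fun a b ↦ ?_⟩, fun c a ↦ ?_⟩, fun _ ↦ rfl⟩
  · apply smul_left_injective ℂ hX
    simp [← h, add_smul]
  · apply smul_left_injective ℂ hX
    simp [← h, mul_smul]

/-- Antisymmetrizing a simultaneous eigenvector of `ad 𝔞` under `σ` gives an element of a
restricted root space. -/
lemma sub_mem_restrictedRootSpace {σ : 𝔤 →ₗ⁅ℂ⁆ 𝔤} (hσinv : ∀ X, σ (σ X) = X)
    {𝔞 : Submodule ℂ 𝔤} (h𝔞q : 𝔞 ≤ antifixedSpace σ) {α : Module.Dual ℂ 𝔞} {X : 𝔤}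
    (h : ∀ a : 𝔞, ⁅(a : 𝔤), X⁆ = α a • X) :
    X - σ X ∈ restrictedRootSpace (antifixedSpace σ) 𝔞 α := by
  refine mem_restrictedRootSpace.2 ⟨mem_antifixedSpace.2 (by simp [hσinv]), fun a ↦ ?_⟩
  have hσ : ⁅(a : 𝔤), σ X⁆ = -(α a • σ X) := by
    have := congrArg σ (h a)
    rw [LieHom.map_lie, mem_antifixedSpace.1 (h𝔞q a.2), map_smul, neg_lie] at this
    rw [← this, neg_neg]
  simp only [lie_sub, h, hσ, lie_smul, lie_neg]
  module

end

/-- **Tangent space of an isotropy orbit (Proposition 3.2 (i)).**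
Let `𝔤` be a finite-dimensional complex semisimple Lie algebra, `σ` an involution with
`𝔥 := ker (σ - id)`, `𝔮 := ker (σ + id)`, and `𝔞` a Cartan subspace of `𝔮`.  Then for
every `w ∈ 𝔞`, the image `{[Z, w] : Z ∈ 𝔥}` of `𝔥` under `Z ↦ [Z, w] = (-(ad w)) Z`
equals the sum of those restricted root spaces `𝔮_α` with `α ∈ Δ` and `α(w) ≠ 0`. -/
theorem isotropy_orbit_tangent_space
    (𝔤 : Type*) [LieRing 𝔤] [LieAlgebra ℂ 𝔤] [FiniteDimensional ℂ 𝔤]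
    [LieAlgebra.IsSemisimple ℂ 𝔤]
    (σ : 𝔤 →ₗ⁅ℂ⁆ 𝔤) (hσinv : ∀ X, σ (σ X) = X)
    (𝔞 : Submodule ℂ 𝔤) (h𝔞q : 𝔞 ≤ antifixedSpace σ)
    (habel : ∀ a ∈ 𝔞, ∀ b ∈ 𝔞, ⁅a, b⁆ = 0)
    (hss : ∀ a ∈ 𝔞, (⨆ μ : ℂ, Module.End.eigenspace (LieAlgebra.ad ℂ 𝔤 a) μ) = ⊤)
    (hmax : ∀ 𝔟 : Submodule ℂ 𝔤, 𝔟 ≤ antifixedSpace σ →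
      (∀ a ∈ 𝔟, ∀ b ∈ 𝔟, ⁅a, b⁆ = 0) →
      (∀ a ∈ 𝔟, (⨆ μ : ℂ, Module.End.eigenspace (LieAlgebra.ad ℂ 𝔤 a) μ) = ⊤) →
      𝔞 ≤ 𝔟 → 𝔟 = 𝔞)
    (w : 𝔞) :
    Submodule.map ((-(LieAlgebra.ad ℂ 𝔤 (w : 𝔤)) : Module.End ℂ 𝔤) : 𝔤 →ₗ[ℂ] 𝔤)
        (fixedSpace σ)
      = ⨆ α ∈ {α : Module.Dual ℂ 𝔞 |
          α ≠ 0 ∧ restrictedRootSpace (antifixedSpace σ) 𝔞 α ≠ ⊥ ∧ α w ≠ 0},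
          restrictedRootSpace (antifixedSpace σ) 𝔞 α := by
  apply le_antisymm
  · have htop := iSup_iInf_eigenspace_eq_top_of_commute
      (fun a : 𝔞 ↦ LieAlgebra.ad ℂ 𝔤 (a : 𝔤))
      (fun a b ↦ LinearMap.ext fun X ↦ by
        simpa [habel a a.2 b b.2] using leibniz_lie (a : 𝔤) (b : 𝔤) X)
      (fun a ↦ hss a a.2)
    set S := ⨆ α ∈ {α : Module.Dual ℂ 𝔞 |
      α ≠ 0 ∧ restrictedRootSpace (antifixedSpace σ) 𝔞 α ≠ ⊥ ∧ α w ≠ 0},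
      restrictedRootSpace (antifixedSpace σ) 𝔞 α
    have key (X : 𝔤) : ⁅(w : 𝔤), X⁆ - σ ⁅(w : 𝔤), X⁆ ∈ S := by
      have hX : X ∈ ⨆ χ : 𝔞 → ℂ, ⨅ a : 𝔞, (LieAlgebra.ad ℂ 𝔤 (a : 𝔤)).eigenspace (χ a) :=
        htop ▸ Submodule.mem_top
      induction hX using Submodule.iSup_induction' with
      | zero => simp
      | add X Y _ _ hX hY =>
        rw [lie_add, map_add, add_sub_add_comm]
        exact add_mem hX hY
      | mem χ X hX =>
        have hX' (a : 𝔞) : ⁅(a : 𝔤), X⁆ = χ a • X := by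
          simpa [Module.End.mem_eigenspace_iff] using (Submodule.mem_iInf _).1 hX a
        rcases eq_or_ne X 0 with rfl | hX0
        · simp
        obtain ⟨α, hα⟩ := exists_dual_of_forall_lie_eq_smul hX0 hX'
        simp only [← hα] at hX'
        rw [hX', map_smul, ← smul_sub]
        by_cases hw : α w = 0
        · simp [hw]
        have hmem := sub_mem_restrictedRootSpace hσinv h𝔞q hX'
        rcases eq_or_ne (X - σ X) 0 with h0 | h0
        · simp [h0]
        refine S.smul_mem _ (Submodule.mem_iSup_of_mem α (Submodule.mem_iSup_of_mem ⟨?_, ?_, hw⟩ hmem))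
        · rintro rfl
          exact hw rfl
        · exact fun h ↦ h0 ((Submodule.eq_bot_iff _).1 h _ hmem)
    rintro _ ⟨Z, hZ, rfl⟩
    have hσZ : σ ⁅(w : 𝔤), Z⁆ = -⁅(w : 𝔤), Z⁆ := by
      rw [LieHom.map_lie, mem_antifixedSpace.1 (h𝔞q w.2), mem_fixedSpace.1 hZ, neg_lie]
    have hZS := S.smul_mem (-(1 / 2) : ℂ) (key Z)
    rw [hσZ] at hZS
    convert hZS using 1
    simp only [LinearMap.neg_apply, LieAlgebra.ad_apply]
    module
  · refine iSup₂_le fun α hα X hX ↦ ?_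
    obtain ⟨hXq, hXα⟩ := mem_restrictedRootSpace.1 hX
    refine ⟨-(α w ^ 2)⁻¹ • ⁅(w : 𝔤), X⁆, mem_fixedSpace.2 ?_, ?_⟩
    · rw [map_smul, LieHom.map_lie, mem_antifixedSpace.1 (h𝔞q w.2), mem_antifixedSpace.1 hXq,
        neg_lie, lie_neg, neg_neg]
    · simp [hXα w, smul_smul, hα.2.2]
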